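/- Let R be a commutative ring, A and B commutative R-algebras with B flat over R, and suppose A ⊗_R B is a Cohen–Macaulay ring and R is Cohen–Macaulay. Then for any prime ideals 𝔭 of A and 𝔮 of B with 𝔭 ∩ R = 𝔮 ∩ R, the localizations A_𝔭 and B_𝔮 are Cohen–Macaulay rings. Conversely, if A_𝔭 and B_𝔮 are Cohen–Macaulay for all such pairs of primes, then A ⊗_R B is Cohen–Macaulay. -/

import Mathlib

open TensorProduct

/-- The depth of a local ring: the supremum of the lengths of regular sequences contained in
the maximal ideal. -/
noncomputable def localRingDepth (R : Type*) [CommRing R] [IsLocalRing R] :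
    WithBot (WithTop ℕ) :=
  sSup {n | ∃ rs : List R, RingTheory.Sequence.IsRegular R rs ∧
    (∀ r ∈ rs, r ∈ IsLocalRing.maximalIdeal R) ∧ n = (rs.length : WithBot (WithTop ℕ))}

/-- A Noetherian local ring is Cohen–Macaulay if its depth equals its Krull dimension. -/
def IsCohenMacaulayLocalRing (R : Type*) [CommRing R] [IsLocalRing R] : Prop :=
  localRingDepth R = ringKrullDim R

/-- A (not necessarily local) ring is Cohen–Macaulay if all its localizations at maximal
ideals are Cohen–Macaulay local rings. -/
def IsCohenMacaulayRing (R : Type*) [CommRing R] : Prop :=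
  ∀ (p : Ideal R) (hm : p.IsMaximal),
    haveI : p.IsPrime := hm.isPrime
    IsCohenMacaulayLocalRing (Localization.AtPrime p)


open RingTheory.Sequence IsLocalRing
open scoped Pointwise

section Depth

universe u

variable {R : Type*} [CommRing R]

/-- If `x` is regular on `M`, every associated prime of `M` lies in one of `M / xM`
containing `x`, provided `x` is in the maximal ideal. -/
lemma exists_mem_associatedPrimes_quotSMulTop [IsLocalRing R] [IsNoetherianRing R]
    {M : Type*} [AddCommGroup M] [Module R M] [Module.Finite R M] {x : R}
    (hx : x ∈ maximalIdeal R) (hreg : IsSMulRegular M x) {p : Ideal R}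
    (hp : p ∈ associatedPrimes R M) :
    ∃ q ∈ associatedPrimes R (QuotSMulTop x M), p ≤ q ∧ x ∈ q := by
  obtain ⟨-, y, hy⟩ := (isAssociatedPrime_iff (I := p) (M := M)).mp hp
  have hp1 : p ≠ ⊤ := hp.1.ne_top
  let N : Submodule R M := Submodule.torsionBySet R M p
  have hN : N ≠ ⊥ := by
    intro h
    have : y ∈ N := by
      rw [Submodule.mem_torsionBySet_iff]
      rintro ⟨a, ha⟩
      rw [SetLike.mem_coe, hy, Submodule.mem_colon_singleton] at ha
      simpa using ha
    rw [h, Submodule.mem_bot] at this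
    subst this
    exact hp1 (by rw [hy]; ext; simp [Submodule.mem_colon_singleton])
  have hNx : ¬ N ≤ x • (⊤ : Submodule R M) := by
    intro h
    apply hN
    refine Submodule.eq_bot_of_le_smul_of_le_jacobson_bot (Ideal.span {x}) N
      (IsNoetherian.noetherian N) ?_ ?_
    · intro z hz
      obtain ⟨w, -, rfl⟩ := Submodule.mem_smul_pointwise_iff_exists _ _ _ |>.mp (h hz)
      refine Submodule.smul_mem_smul (Ideal.mem_span_singleton_self x) ?_
      rw [Submodule.mem_torsionBySet_iff] at hz ⊢
      intro a
      apply hreg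
      simpa [smul_comm x] using hz a
    · rw [IsLocalRing.jacobson_eq_maximalIdeal ⊥ bot_ne_top, Ideal.span_singleton_le_iff_mem]
      exact hx
  obtain ⟨z, hz, hzx⟩ := SetLike.not_le_iff_exists.mp hNx
  obtain ⟨q, hq, hle⟩ := exists_le_isAssociatedPrime_of_isNoetherianRing R
    (Submodule.Quotient.mk z : QuotSMulTop x M)
    (by rwa [Ne, Submodule.Quotient.mk_eq_zero])
  refine ⟨q, hq, fun a ha ↦ hle ?_, hle ?_⟩
  · rw [Submodule.mem_colon_singleton, Submodule.mem_bot, ← Submodule.Quotient.mk_smul]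
    rw [Submodule.mem_torsionBySet_iff] at hz
    rw [hz ⟨a, ha⟩, Submodule.Quotient.mk_zero]
  · rw [Submodule.mem_colon_singleton, Submodule.mem_bot, ← Submodule.Quotient.mk_smul,
      Submodule.Quotient.mk_eq_zero]
    exact Submodule.smul_mem_pointwise_smul _ _ _ trivial

lemma ringKrullDim_quotient_add_one_le {p q : Ideal R} [hp : p.IsPrime] (hpq : p ≤ q) {x : R}
    (hxp : x ∉ p) (hxq : x ∈ q) : ringKrullDim (R ⧸ q) + 1 ≤ ringKrullDim (R ⧸ p) :=
  ringKrullDim_succ_le_of_surjective (Ideal.Quotient.factor hpq)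
    (Ideal.Quotient.factor_surjective hpq) (r := Ideal.Quotient.mk p x)
    (mem_nonZeroDivisors_of_ne_zero (by rwa [Ne, Ideal.Quotient.eq_zero_iff_mem]))
    (by simpa [Ideal.Quotient.eq_zero_iff_mem] using hxq)

lemma notMem_of_mem_associatedPrimes_of_isSMulRegular [IsNoetherianRing R]
    {M : Type*} [AddCommGroup M] [Module R M] {x : R} (hreg : IsSMulRegular M x) {p : Ideal R}
    (hp : p ∈ associatedPrimes R M) : x ∉ p := by
  intro hx
  have : x ∈ ⋃ p ∈ associatedPrimes R M, (p : Set R) := Set.mem_biUnion hp hx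
  rw [biUnion_associatedPrimes_eq_compl_regular] at this
  exact this hreg

/-- The length of a regular sequence on `M` is at most `dim R ⧸ p` for every associated prime
`p` of `M`. -/
lemma length_le_ringKrullDim_quotient_of_mem_associatedPrimes [IsLocalRing R] [IsNoetherianRing R]
    {M : Type*} [AddCommGroup M] [Module R M] [Module.Finite R M] {rs : List R}
    (hreg : IsWeaklyRegular M rs) (hrs : ∀ r ∈ rs, r ∈ maximalIdeal R) {p : Ideal R}
    (hp : p ∈ associatedPrimes R M) : (rs.length : WithBot ℕ∞) ≤ ringKrullDim (R ⧸ p) := by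
  induction rs generalizing M p with
  | nil =>
    have := Ideal.Quotient.nontrivial_iff.mpr hp.1.ne_top
    simpa using ringKrullDim_nonneg_of_nontrivial
  | cons x rs ih =>
    rw [isWeaklyRegular_cons_iff] at hreg
    obtain ⟨q, hq, hpq, hxq⟩ :=
      exists_mem_associatedPrimes_quotSMulTop (hrs x List.mem_cons_self) hreg.1 hp
    have := hp.1
    refine le_trans ?_ (ringKrullDim_quotient_add_one_le hpq
      (notMem_of_mem_associatedPrimes_of_isSMulRegular hreg.1 hp) hxq)
    rw [List.length_cons, Nat.cast_succ]
    gcongr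
    exact ih hreg.2 (fun r hr ↦ hrs r (List.mem_cons_of_mem _ hr)) hq

lemma IsLocalRing.smul_top_lt_top [IsLocalRing R] {M : Type*} [AddCommGroup M] [Module R M]
    [Module.Finite R M] [Nontrivial M] : maximalIdeal R • (⊤ : Submodule R M) < ⊤ :=
  lt_top_iff_ne_top.mpr (Submodule.top_ne_ideal_smul_of_le_jacobson_annihilator
    (maximalIdeal_le_jacobson _)).symm

open CategoryTheory Abelian in
lemma subsingleton_ext_quotSMulTop {R : Type u} [CommRing R] (N M : ModuleCat.{u} R) {x : R}
    (hreg : IsSMulRegular M x) (n : ℕ)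
    (h : ∀ i < n + 1, Subsingleton (Ext N M i)) :
    ∀ i < n, Subsingleton (Ext N (ModuleCat.of R (QuotSMulTop x M)) i) := by
  intro i hi
  have zero1 := AddCommGrpCat.isZero_of_iff_subsingleton.mpr (h i (by omega))
  have zero2 := AddCommGrpCat.isZero_of_iff_subsingleton.mpr (h (i + 1) (by omega))
  exact AddCommGrpCat.subsingleton_of_isZero <| ShortComplex.Exact.isZero_of_both_zeros
    ((Ext.covariant_sequence_exact₃' N hreg.smulShortComplex_shortExact) i (i + 1) rfl)
    (zero1.eq_zero_of_src _) (zero2.eq_zero_of_tgt _)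

lemma isWeaklyRegular_of_subsingleton {M : Type*} [AddCommGroup M] [Module R M] [Subsingleton M]
    (rs : List R) : IsWeaklyRegular M rs := by
  induction rs generalizing M with
  | nil => exact .nil _ _
  | cons r rs ih =>
    have : Subsingleton (QuotSMulTop r M) := (Submodule.mkQ_surjective _).subsingleton
    exact .cons (fun _ _ _ ↦ Subsingleton.elim _ _) ih

/-- If `M` admits a regular sequence of length `n`, then `M / xM` admits one of length `n - 1`
for every regular element `x` of `M`. -/
lemma exists_isWeaklyRegular_quotSMulTop {R : Type u} [CommRing R] [IsLocalRing R]
    [IsNoetherianRing R] {M : Type u} [AddCommGroup M] [Module R M] [Module.Finite R M]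
    {x : R} (hx : x ∈ maximalIdeal R) (hreg : IsSMulRegular M x) {rs : List R}
    (hrs : IsWeaklyRegular M rs) (hmem : ∀ r ∈ rs, r ∈ maximalIdeal R) :
    ∃ rs' : List R, IsWeaklyRegular (QuotSMulTop x M) rs' ∧ (∀ r ∈ rs', r ∈ maximalIdeal R) ∧
      rs.length ≤ rs'.length + 1 := by
  rcases subsingleton_or_nontrivial M with hM | hM
  · have : Subsingleton (QuotSMulTop x M) := (Submodule.mkQ_surjective _).subsingleton
    exact ⟨rs, isWeaklyRegular_of_subsingleton rs, hmem, by omega⟩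
  have : Nontrivial (QuotSMulTop x M) := nontrivial_quotSMulTop_of_mem_maximalIdeal M hx
  cases hn : rs.length with
  | zero => exact ⟨[], .nil _ _, by simp, Nat.zero_le _⟩
  | succ n =>
    have h1 : ∃ rs : List R, rs.length = n + 1 ∧ (∀ r ∈ rs, r ∈ maximalIdeal R) ∧
        IsRegular M rs :=
      ⟨rs, hn, hmem, .of_isWeaklyRegular_of_mem_maximalIdeal M hmem hrs⟩
    have h2 := ((ModuleCat.exists_isRegular_tfae (maximalIdeal R) (n + 1) (ModuleCat.of R M)
      IsLocalRing.smul_top_lt_top).out 1 3).mpr h1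
    obtain ⟨rs', hlen, hmem', hreg'⟩ := ((ModuleCat.exists_isRegular_tfae (maximalIdeal R) n
      (ModuleCat.of R (QuotSMulTop x M)) IsLocalRing.smul_top_lt_top).out 1 3).mp
        (subsingleton_ext_quotSMulTop _ _ hreg n h2)
    exact ⟨rs', hreg'.1, hmem', by omega⟩

/-- If `M` admits a regular sequence of length `n`, then so does, up to its length, the quotient
of `M` by any other regular sequence. -/
lemma exists_isWeaklyRegular_quotient_ofList {R : Type u} [CommRing R] [IsLocalRing R]
    [IsNoetherianRing R] {M : Type u} [AddCommGroup M] [Module R M] [Module.Finite R M]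
    {xs : List R} (hxs : IsWeaklyRegular M xs) (hxmem : ∀ r ∈ xs, r ∈ maximalIdeal R) {rs : List R}
    (hrs : IsWeaklyRegular M rs) (hmem : ∀ r ∈ rs, r ∈ maximalIdeal R) :
    ∃ rs' : List R, IsWeaklyRegular (M ⧸ Ideal.ofList xs • (⊤ : Submodule R M)) rs' ∧
      (∀ r ∈ rs', r ∈ maximalIdeal R) ∧ rs.length ≤ rs'.length + xs.length := by
  induction xs generalizing M rs with
  | nil =>
    refine ⟨rs, ?_, hmem, by simp⟩
    exact ((Submodule.quotEquivOfEqBot _ (by simp)).isWeaklyRegular_congr rs).mpr hrs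
  | cons x xs ih =>
    rw [isWeaklyRegular_cons_iff] at hxs
    obtain ⟨rs₁, h1, h2, h3⟩ := exists_isWeaklyRegular_quotSMulTop
      (hxmem x List.mem_cons_self) hxs.1 hrs hmem
    obtain ⟨rs', h1', h2', h3'⟩ :=
      ih hxs.2 (fun r hr ↦ hxmem r (List.mem_cons_of_mem _ hr)) h1 h2
    refine ⟨rs', ?_, h2', by rw [List.length_cons]; omega⟩
    exact ((Submodule.quotOfListConsSMulTopEquivQuotSMulTopInner M x xs).isWeaklyRegular_congr
      rs').mpr h1'

lemma length_le_ringKrullDim_of_isWeaklyRegular [IsLocalRing R] [IsNoetherianRing R]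
    {M : Type*} [AddCommGroup M] [Module R M] [Module.Finite R M] [Nontrivial M] {rs : List R}
    (hreg : IsWeaklyRegular M rs) (hrs : ∀ r ∈ rs, r ∈ maximalIdeal R) :
    (rs.length : WithBot ℕ∞) ≤ ringKrullDim R := by
  obtain ⟨p, hp⟩ := associatedPrimes.nonempty R M
  exact (length_le_ringKrullDim_quotient_of_mem_associatedPrimes hreg hrs hp).trans
    (ringKrullDim_quotient_le p)

lemma exists_nat_ringKrullDim_eq (R : Type*) [CommRing R] [IsLocalRing R] [IsNoetherianRing R] :
    ∃ d : ℕ, ringKrullDim R = d := by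
  have h := ringKrullDim_lt_top (R := R)
  have h' := ringKrullDim_ne_bot (R := R)
  generalize ringKrullDim R = x at h h'
  induction x with
  | bot => exact absurd rfl h'
  | coe x =>
    induction x with
    | top => exact absurd rfl h.ne
    | coe d => exact ⟨d, rfl⟩

/-- In an ideal `I` of a local ring there is a regular sequence on `M` which cannot be extended
inside `I`. -/
lemma exists_isWeaklyRegular_exists_le_mem_associatedPrimes [IsLocalRing R] [IsNoetherianRing R]
    (M : Type*) [AddCommGroup M] [Module R M] [Module.Finite R M] [Nontrivial M] {I : Ideal R}
    (hI : I ≤ maximalIdeal R) :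
    ∃ rs : List R, IsWeaklyRegular M rs ∧ (∀ r ∈ rs, r ∈ I) ∧
      ∃ q ∈ associatedPrimes R (M ⧸ Ideal.ofList rs • (⊤ : Submodule R M)), I ≤ q := by
  obtain ⟨d, hd⟩ := exists_nat_ringKrullDim_eq R
  let P (n : ℕ) : Prop := ∃ rs : List R, rs.length = n ∧ IsWeaklyRegular M rs ∧ ∀ r ∈ rs, r ∈ I
  have hP : ∀ n, P n → n ≤ d := by
    rintro n ⟨rs, rfl, h1, h2⟩
    have := length_le_ringKrullDim_of_isWeaklyRegular h1 (fun r hr ↦ hI (h2 r hr))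
    rw [hd] at this
    exact_mod_cast this
  classical
  obtain ⟨rs, hlen, hreg, hmem⟩ : P (Nat.findGreatest P d) :=
    Nat.findGreatest_spec (Nat.zero_le d) ⟨[], rfl, .nil _ _, by simp⟩
  refine ⟨rs, hreg, hmem, ?_⟩
  refine (Ideal.subset_union_prime_finite (f := id) (associatedPrimes.finite R _) ⊤ ⊤
    (fun p hp _ _ ↦ hp.1)).mp ?_
  simp only [id]
  rw [biUnion_associatedPrimes_eq_compl_regular]
  intro x hx hxreg
  have : P (rs.length + 1) := by
    refine ⟨rs ++ [x], by simp, ?_, ?_⟩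
    · rw [isWeaklyRegular_append_iff]
      exact ⟨hreg, (isWeaklyRegular_singleton_iff _ _).mpr hxreg⟩
    · simpa [or_imp, forall_and] using ⟨hmem, hx⟩
  have := Nat.le_findGreatest (hP _ this) this
  omega

end Depth

section CohenMacaulay

lemma isCohenMacaulayLocalRing_iff {R : Type*} [CommRing R] [IsLocalRing R]
    [IsNoetherianRing R] :
    IsCohenMacaulayLocalRing R ↔ ∃ rs : List R, IsWeaklyRegular R rs ∧
      (∀ r ∈ rs, r ∈ maximalIdeal R) ∧ ringKrullDim R ≤ rs.length := by
  obtain ⟨d, hd⟩ := exists_nat_ringKrullDim_eq R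
  rw [IsCohenMacaulayLocalRing, localRingDepth]
  have hle : ∀ rs : List R, IsWeaklyRegular R rs → (∀ r ∈ rs, r ∈ maximalIdeal R) →
      rs.length ≤ d := by
    intro rs h1 h2
    have := length_le_ringKrullDim_of_isWeaklyRegular h1 h2
    rw [hd] at this
    exact_mod_cast this
  rw [hd]
  constructor
  · intro h
    by_contra! hcon
    have hlt : ∀ rs : List R, IsWeaklyRegular R rs → (∀ r ∈ rs, r ∈ maximalIdeal R) →
        rs.length < d := fun rs h1 h2 ↦ by exact_mod_cast hcon rs h1 h2
    have hd0 : 0 < d := hlt [] (.nil _ _) (by simp)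
    have : (d : WithBot ℕ∞) ≤ (d - 1 : ℕ) := by
      rw [← h]
      refine sSup_le ?_
      rintro _ ⟨rs, h1, h2, rfl⟩
      have := hlt rs h1.1 h2
      have : (rs.length : WithBot ℕ∞) ≤ (d - 1 : ℕ) := by
        exact_mod_cast (by omega : rs.length ≤ d - 1)
      exact this
    have : d ≤ d - 1 := by exact_mod_cast this
    omega
  · rintro ⟨rs, h1, h2, h3⟩
    have h3 : d ≤ rs.length := by exact_mod_cast h3
    refine le_antisymm (sSup_le ?_) (le_sSup ⟨rs, ?_, h2, ?_⟩)
    · rintro _ ⟨rs, h1, h2, rfl⟩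
      have : (rs.length : WithBot ℕ∞) ≤ d := by exact_mod_cast hle rs h1.1 h2
      exact this
    · exact .of_isWeaklyRegular_of_mem_maximalIdeal R h2 h1
    · rw [le_antisymm (hle rs h1 h2) h3]
      rfl

lemma IsCohenMacaulayLocalRing.of_ringEquiv {R S : Type*} [CommRing R] [CommRing S]
    [IsLocalRing R] [IsLocalRing S] [IsNoetherianRing R] (e : R ≃+* S)
    (h : IsCohenMacaulayLocalRing R) : IsCohenMacaulayLocalRing S := by
  have : IsNoetherianRing S := isNoetherianRing_of_ringEquiv R e
  rw [isCohenMacaulayLocalRing_iff] at h ⊢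
  obtain ⟨rs, h1, h2, h3⟩ := h
  refine ⟨rs.map e, ?_, ?_, ?_⟩
  · have : List.Forall₂ (fun a b ↦ ∀ x : R, e (a • x) = b • e x) rs (rs.map e) := by
      simp [List.forall₂_map_right_iff, List.forall₂_same]
    exact (AddEquiv.isWeaklyRegular_congr (e := e.toAddEquiv) this).mp h1
  · simp only [List.mem_map, forall_exists_index, and_imp, forall_apply_eq_imp_iff₂]
    intro r hr
    simpa using h2 r hr
  · rwa [← ringKrullDim_eq_of_ringEquiv e, List.length_map]

lemma height_add_ringKrullDim_quotient_le {R : Type*} [CommRing R] (p : Ideal R)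
    [hp : p.IsPrime] : (p.height : WithBot ℕ∞) + ringKrullDim (R ⧸ p) ≤ ringKrullDim R := by
  let P : PrimeSpectrum R := ⟨p, hp⟩
  have : Nonempty (PrimeSpectrum R) := ⟨P⟩
  have h1 : ringKrullDim (R ⧸ p) = (Order.coheight P : WithBot ℕ∞) := by
    rw [ringKrullDim_quotient, Order.coheight_eq_krullDim_Ici]
    rfl
  have h2 : p.height = Order.height P := by
    exact PrimeSpectrum.height_eq_orderHeight P
  rw [h1, h2, ringKrullDim, Order.krullDim_eq_iSup_height_add_coheight_of_nonempty]
  exact_mod_cast le_iSup (fun a : PrimeSpectrum R ↦ Order.height a + Order.coheight a) P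

/-- Localizations of Cohen–Macaulay local rings are Cohen–Macaulay. -/
theorem IsCohenMacaulayLocalRing.localization {R : Type*} [CommRing R] [IsLocalRing R]
    [IsNoetherianRing R] (h : IsCohenMacaulayLocalRing R) (p : Ideal R) [hp : p.IsPrime] :
    IsCohenMacaulayLocalRing (Localization.AtPrime p) := by
  rw [isCohenMacaulayLocalRing_iff] at h ⊢
  obtain ⟨rs, h1, h2, h3⟩ := h
  obtain ⟨xs, h4, h5, q, hq, hpq⟩ := exists_isWeaklyRegular_exists_le_mem_associatedPrimes R
    (IsLocalRing.le_maximalIdeal hp.ne_top)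
  have h5' : ∀ r ∈ xs, r ∈ maximalIdeal R :=
    fun r hr ↦ IsLocalRing.le_maximalIdeal hp.ne_top (h5 r hr)
  obtain ⟨ys, h6, h7, h8⟩ := exists_isWeaklyRegular_quotient_ofList h4 h5' h1 h2
  refine ⟨xs.map (algebraMap R _), h4.of_isLocalization _ p.primeCompl, ?_, ?_⟩
  · simp only [List.mem_map, forall_exists_index, and_imp, forall_apply_eq_imp_iff₂]
    intro r hr
    exact (IsLocalization.AtPrime.to_map_mem_maximal_iff _ p r).mpr (h5 r hr)
  · rw [IsLocalization.AtPrime.ringKrullDim_eq_height p, List.length_map]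
    have h9 := length_le_ringKrullDim_quotient_of_mem_associatedPrimes h6 h7 hq
    have := hq.1
    have h10 := height_add_ringKrullDim_quotient_le q
    have h11 : (p.height : WithBot ℕ∞) ≤ q.height := by exact_mod_cast Ideal.height_mono hpq
    have h12 : (p.height : WithBot ℕ∞) + ys.length ≤ ys.length + xs.length :=
      (add_le_add h11 h9).trans (h10.trans (h3.trans (by exact_mod_cast h8)))
    obtain ⟨n, hn⟩ : ∃ n : ℕ, p.height = n :=
      ⟨_, (ENat.natCast_toNat (Ideal.height_ne_top hp.ne_top)).symm⟩
    rw [hn] at h12 ⊢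
    have : n + ys.length ≤ ys.length + xs.length := by exact_mod_cast h12
    exact_mod_cast (by omega : n ≤ xs.length)

end CohenMacaulay

section FiniteLength

/-- Weak regularity of a sequence passes to extensions. -/
lemma isWeaklyRegular_of_exact {S : Type*} [CommRing S] {M M' M'' : Type*} [AddCommGroup M]
    [Module S M] [AddCommGroup M'] [Module S M'] [AddCommGroup M''] [Module S M'']
    {f : M →ₗ[S] M'} {g : M' →ₗ[S] M''} (hf : Function.Injective f) (hfg : Function.Exact f g)
    (hg : Function.Surjective g) {ys : List S} (h : IsWeaklyRegular M ys)
    (h'' : IsWeaklyRegular M'' ys) : IsWeaklyRegular M' ys := by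
  induction ys generalizing M M' M'' with
  | nil => exact .nil _ _
  | cons y ys ih =>
    rw [isWeaklyRegular_cons_iff] at h h'' ⊢
    refine ⟨isSMulRegular_of_range_eq_ker hf (LinearMap.exact_iff.mp hfg).symm h.1 h''.1, ?_⟩
    refine ih (f := QuotSMulTop.map y f) (g := QuotSMulTop.map y g) ?_
      (QuotSMulTop.map_exact y hfg hg) (QuotSMulTop.map_surjective y hg) h.2 h''.2
    have h0 : Function.Exact (0 : PUnit →ₗ[S] M) f := by
      rw [LinearMap.exact_zero_iff_injective]
      exact hf
    have := QuotSMulTop.map_first_exact_on_four_term_exact_of_isSMulRegular_last h0 hfg h''.1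
    rwa [map_zero, LinearMap.exact_zero_iff_injective] at this

variable {R S : Type*} [CommRing R] [CommRing S] [Algebra R S]

lemma isWeaklyRegular_tensor_of_isFiniteLength [IsLocalRing R] [Module.Flat R S] {ys : List S}
    (h : IsWeaklyRegular (S ⊗[R] (R ⧸ maximalIdeal R)) ys) {N : Type*} [AddCommGroup N]
    [Module R N] (hN : IsFiniteLength R N) : IsWeaklyRegular (S ⊗[R] N) ys := by
  induction hN with
  | of_subsingleton => exact isWeaklyRegular_of_subsingleton _
  | @of_simple_quotient M _ _ N _ hN ih =>
    have hsimple : IsWeaklyRegular (S ⊗[R] (M ⧸ N)) ys := by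
      obtain ⟨I, hI, ⟨e⟩⟩ := isSimpleModule_iff_quot_maximal.mp ‹IsSimpleModule R (M ⧸ N)›
      obtain rfl := IsLocalRing.eq_maximalIdeal hI
      exact ((e.baseChange R S _ _).isWeaklyRegular_congr ys).mpr h
    refine isWeaklyRegular_of_exact (f := N.subtype.baseChange S) (g := N.mkQ.baseChange S)
      ?_ ?_ ?_ ih hsimple
    · exact Module.Flat.lTensor_preserves_injective_linearMap _ N.injective_subtype
    · exact lTensor_exact S (LinearMap.exact_subtype_mkQ N) N.mkQ_surjective
    · exact LinearMap.lTensor_surjective S N.mkQ_surjective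

lemma isFiniteLength_quotient_ofList [IsLocalRing R] [IsNoetherianRing R] {xs : List R}
    (h : IsWeaklyRegular R xs) (hmem : ∀ r ∈ xs, r ∈ maximalIdeal R)
    (hdim : ringKrullDim R ≤ xs.length) : IsFiniteLength R (R ⧸ Ideal.ofList xs) := by
  have h1 := ringKrullDim_add_length_eq_ringKrullDim_of_isRegular xs
    (.of_isWeaklyRegular_of_mem_maximalIdeal R hmem h)
  have h2 : ringKrullDim (R ⧸ Ideal.ofList xs) ≤ 0 := by
    rw [← h1] at hdim
    generalize ringKrullDim (R ⧸ Ideal.ofList xs) = x at hdim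
    induction x with
    | bot => exact bot_le
    | coe x =>
      induction x with
      | top =>
        have : (⊤ : ℕ∞) + xs.length ≤ xs.length := by exact_mod_cast hdim
        rw [top_add] at this
        simp at this
      | coe n =>
        have : n + xs.length ≤ xs.length := by exact_mod_cast hdim
        have : n = 0 := by omega
        subst this
        rfl
  have : Ring.KrullDimLE 0 (R ⧸ Ideal.ofList xs) := by
    rw [Ring.krullDimLE_iff]
    exact_mod_cast h2
  have : IsArtinianRing (R ⧸ Ideal.ofList xs) :=
    isArtinianRing_iff_isNoetherianRing_krullDimLE_zero.mpr ⟨inferInstance, this⟩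
  rw [isFiniteLength_iff_isNoetherian_isArtinian]
  exact ⟨inferInstance, isArtinian_of_surjective_algebraMap (S := R) (R := R ⧸ Ideal.ofList xs)
    Ideal.Quotient.mk_surjective⟩

/-- Reducing a flat algebra modulo a sequence of `R`. -/
noncomputable def quotientOfListEquivTensor (S : Type*) [CommRing S] [Algebra R S] (xs : List R) :
    (S ⧸ Ideal.ofList (xs.map (algebraMap R S)) • (⊤ : Submodule S S)) ≃ₗ[S]
      S ⊗[R] (R ⧸ Ideal.ofList xs) :=
  Submodule.quotEquivOfEq _ _ (by rw [smul_eq_mul, Ideal.mul_top, Ideal.map_ofList]) ≪≫ₗ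
    (Algebra.TensorProduct.quotIdealMapEquivTensorQuot S (Ideal.ofList xs)).toLinearEquiv

lemma isCohenMacaulayLocalRing_iff_of_surjective {S F : Type*} [CommRing S] [CommRing F]
    [Algebra S F] [IsLocalRing S] [IsLocalRing F] [IsNoetherianRing F]
    (hF : Function.Surjective (algebraMap S F)) :
    IsCohenMacaulayLocalRing F ↔ ∃ rs : List S, IsWeaklyRegular F rs ∧
      (∀ r ∈ rs, r ∈ maximalIdeal S) ∧ ringKrullDim F ≤ rs.length := by
  have : IsLocalHom (algebraMap S F) := .of_surjective _ hF
  have hmem (r : S) : algebraMap S F r ∈ maximalIdeal F ↔ r ∈ maximalIdeal S := by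
    rw [mem_maximalIdeal, mem_maximalIdeal, map_mem_nonunits_iff]
  rw [isCohenMacaulayLocalRing_iff]
  constructor
  · rintro ⟨rs, h1, h2, h3⟩
    obtain ⟨rs, rfl⟩ := List.map_surjective_iff.mpr hF rs
    refine ⟨rs, (isWeaklyRegular_map_algebraMap_iff F F rs).mp h1, fun r hr ↦ ?_, by simpa using h3⟩
    exact (hmem r).mp (h2 _ (List.mem_map_of_mem hr))
  · rintro ⟨rs, h1, h2, h3⟩
    refine ⟨rs.map (algebraMap S F), (isWeaklyRegular_map_algebraMap_iff F F rs).mpr h1, ?_,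
      by simpa using h3⟩
    simpa [hmem] using h2

end FiniteLength

section LocalFlat

variable {R S : Type*} [CommRing R] [CommRing S] [Algebra R S] [IsLocalRing R] [IsLocalRing S]
  [IsNoetherianRing R] [IsNoetherianRing S] [IsLocalHom (algebraMap R S)] [Module.Flat R S]

lemma ringKrullDim_eq_add_ringKrullDim_quotient_map_maximalIdeal
    [IsLocalRing (S ⧸ (maximalIdeal R).map (algebraMap R S))] :
    ringKrullDim S =
      ringKrullDim R + ringKrullDim (S ⧸ (maximalIdeal R).map (algebraMap R S)) := by
  have : (maximalIdeal S).LiesOver (maximalIdeal R) :=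
    ⟨(IsLocalRing.maximalIdeal_comap (algebraMap R S)).symm⟩
  have h := Ideal.height_eq_height_add_of_liesOver_of_hasGoingDown
    (maximalIdeal R) (maximalIdeal S)
  have h2 : (maximalIdeal S).map (Ideal.Quotient.mk ((maximalIdeal R).map (algebraMap R S))) =
      maximalIdeal _ := by
    have := IsLocalHom.of_surjective
      (Ideal.Quotient.mk ((maximalIdeal R).map (algebraMap R S))) Ideal.Quotient.mk_surjective
    refine IsLocalRing.eq_maximalIdeal (Ideal.map_eq_top_or_isMaximal_of_surjective _
      Ideal.Quotient.mk_surjective (maximalIdeal.isMaximal S) |>.resolve_left ?_)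
    exact (IsLocalRing.map_maximalIdeal_lt_top _).ne
  rw [h2] at h
  rw [← maximalIdeal_height_eq_ringKrullDim, ← maximalIdeal_height_eq_ringKrullDim, h,
    ← maximalIdeal_height_eq_ringKrullDim]
  rfl

/-- The residue-field reduction of a flat local homomorphism as a tensor product. -/
noncomputable def quotientMapMaximalIdealEquivTensor (R S : Type*) [CommRing R] [CommRing S]
    [Algebra R S] [IsLocalRing R] :
    (S ⧸ (maximalIdeal R).map (algebraMap R S)) ≃ₗ[S] S ⊗[R] (R ⧸ maximalIdeal R) :=
  (Algebra.TensorProduct.quotIdealMapEquivTensorQuot S (maximalIdeal R)).toLinearEquiv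

/-- A flat local extension of a Cohen–Macaulay local ring with Cohen–Macaulay closed fibre is
Cohen–Macaulay. -/
theorem IsCohenMacaulayLocalRing.of_flat
    [IsLocalRing (S ⧸ (maximalIdeal R).map (algebraMap R S))]
    (hR : IsCohenMacaulayLocalRing R)
    (hF : IsCohenMacaulayLocalRing (S ⧸ (maximalIdeal R).map (algebraMap R S))) :
    IsCohenMacaulayLocalRing S := by
  rw [isCohenMacaulayLocalRing_iff] at hR ⊢
  rw [isCohenMacaulayLocalRing_iff_of_surjective (S := S) Ideal.Quotient.mk_surjective] at hF
  obtain ⟨xs, h1, h2, h3⟩ := hR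
  obtain ⟨ys, h4, h5, h6⟩ := hF
  rw [(quotientMapMaximalIdealEquivTensor R S).isWeaklyRegular_congr] at h4
  refine ⟨xs.map (algebraMap R S) ++ ys, ?_, ?_, ?_⟩
  · rw [isWeaklyRegular_append_iff]
    refine ⟨h1.of_flat, ?_⟩
    rw [(quotientOfListEquivTensor S xs).isWeaklyRegular_congr]
    exact isWeaklyRegular_tensor_of_isFiniteLength h4 (isFiniteLength_quotient_ofList h1 h2 h3)
  · simp only [List.mem_append, List.mem_map]
    rintro _ (⟨r, hr, rfl⟩ | hr)
    · exact map_nonunit _ r (h2 r hr)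
    · exact h5 _ hr
  · rw [ringKrullDim_eq_add_ringKrullDim_quotient_map_maximalIdeal (R := R)]
    simpa using add_le_add h3 h6

/-- If a flat local extension is Cohen–Macaulay, then so are the base and the closed fibre. -/
theorem IsCohenMacaulayLocalRing.and_of_flat
    [IsLocalRing (S ⧸ (maximalIdeal R).map (algebraMap R S))] (hS : IsCohenMacaulayLocalRing S) :
    IsCohenMacaulayLocalRing R ∧
      IsCohenMacaulayLocalRing (S ⧸ (maximalIdeal R).map (algebraMap R S)) := by
  have hdim := ringKrullDim_eq_add_ringKrullDim_quotient_map_maximalIdeal (R := R) (S := S)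
  set F := S ⧸ (maximalIdeal R).map (algebraMap R S)
  rw [isCohenMacaulayLocalRing_iff] at hS
  obtain ⟨zs, hz1, hz2, hz3⟩ := hS
  obtain ⟨d, hd⟩ := exists_nat_ringKrullDim_eq R
  obtain ⟨e, he⟩ := exists_nat_ringKrullDim_eq F
  rw [hdim, hd, he] at hz3
  have hz3 : d + e ≤ zs.length := by exact_mod_cast hz3
  let eF : F ≃ₗ[S] S ⊗[R] (R ⧸ maximalIdeal R) := quotientMapMaximalIdealEquivTensor R S
  obtain ⟨xs, hx1, hx2, m, hm, hmle⟩ :=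
    exists_isWeaklyRegular_exists_le_mem_associatedPrimes R (le_refl (maximalIdeal R))
  obtain rfl : m = maximalIdeal R :=
    le_antisymm (IsLocalRing.le_maximalIdeal hm.1.ne_top) hmle
  have hxs : Ideal.ofList xs • (⊤ : Submodule R R) = Ideal.ofList xs := by
    rw [smul_eq_mul, Ideal.mul_top]
  rw [hxs] at hm
  obtain ⟨-, ι, hι⟩ := (isAssociatedPrime_iff_exists_injective_linearMap _ _).mp hm
  have hxle : xs.length ≤ d := by
    have := length_le_ringKrullDim_of_isWeaklyRegular hx1 hx2
    rw [hd] at this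
    exact_mod_cast this
  have hx1S : IsWeaklyRegular S (xs.map (algebraMap R S)) := hx1.of_flat
  have hx2S : ∀ r ∈ xs.map (algebraMap R S), r ∈ maximalIdeal S := by
    simp only [List.mem_map]
    rintro _ ⟨r, hr, rfl⟩
    exact map_nonunit _ r (hx2 r hr)
  obtain ⟨zs', hz1', hz2', hz3'⟩ := exists_isWeaklyRegular_quotient_ofList hx1S hx2S hz1 hz2
  rw [List.length_map] at hz3'
  let M := S ⧸ Ideal.ofList (xs.map (algebraMap R S)) • (⊤ : Submodule S S)
  let eM : M ≃ₗ[S] S ⊗[R] (R ⧸ Ideal.ofList xs) := quotientOfListEquivTensor S xs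
  let j : S ⊗[R] (R ⧸ maximalIdeal R) →ₗ[S] M := eM.symm.toLinearMap ∘ₗ ι.baseChange S
  have hj : Function.Injective j := eM.symm.injective.comp
    (Module.Flat.lTensor_preserves_injective_linearMap ι hι)
  have : Nontrivial (S ⊗[R] (R ⧸ maximalIdeal R)) := eF.symm.toEquiv.nontrivial
  have : Module.Finite S (S ⊗[R] (R ⧸ maximalIdeal R)) := .equiv eF
  -- the base
  have hdx : d ≤ xs.length := by
    obtain ⟨P, hP⟩ := associatedPrimes.nonempty S F
    have hPM : P ∈ associatedPrimes S M :=
      associatedPrimes.subset_of_injective (f := j ∘ₗ eF.toLinearMap) (hj.comp eF.injective) hP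
    have h1 := length_le_ringKrullDim_quotient_of_mem_associatedPrimes hz1' hz2' hPM
    have hle : (maximalIdeal R).map (algebraMap R S) ≤ P := by
      refine le_trans ?_ hP.annihilator_le
      rw [Submodule.annihilator_top, Ideal.annihilator_quotient]
    have h2 : ringKrullDim (S ⧸ P) ≤ ringKrullDim F :=
      ringKrullDim_le_of_surjective (Ideal.Quotient.factor hle)
        (Ideal.Quotient.factor_surjective hle)
    have h3 := h1.trans h2
    rw [he] at h3
    have h3 : zs'.length ≤ e := by exact_mod_cast h3
    omega
  have hR : ringKrullDim R ≤ xs.length := by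
    rw [hd]
    exact_mod_cast hdx
  refine ⟨isCohenMacaulayLocalRing_iff.mpr ⟨xs, hx1, hx2, hR⟩, ?_⟩
  -- the fibre
  have hfl := isFiniteLength_quotient_ofList hx1 hx2 hR
  obtain ⟨ys, hy1, hy2, q, hq, hqle⟩ := exists_isWeaklyRegular_exists_le_mem_associatedPrimes
    (S ⊗[R] (R ⧸ maximalIdeal R)) (le_refl (maximalIdeal S))
  obtain rfl : q = maximalIdeal S :=
    le_antisymm (IsLocalRing.le_maximalIdeal hq.1.ne_top) hqle
  rw [isCohenMacaulayLocalRing_iff_of_surjective (S := S) Ideal.Quotient.mk_surjective]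
  refine ⟨ys, (eF.isWeaklyRegular_congr ys).mpr hy1, hy2, ?_⟩
  have hy1M : IsWeaklyRegular M ys :=
    (eM.isWeaklyRegular_congr ys).mpr (isWeaklyRegular_tensor_of_isFiniteLength hy1 hfl)
  obtain ⟨zs'', hz1'', hz2'', hz3''⟩ := exists_isWeaklyRegular_quotient_ofList hy1M hy2 hz1' hz2'
  let C := (R ⧸ Ideal.ofList xs) ⧸ LinearMap.range ι
  have hyC : IsWeaklyRegular (S ⊗[R] C) ys := isWeaklyRegular_tensor_of_isFiniteLength hy1
    (hfl.of_surjective (LinearMap.range ι).mkQ_surjective)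
  let π : M →ₗ[S] S ⊗[R] C := (LinearMap.range ι).mkQ.baseChange S ∘ₗ eM.toLinearMap
  have hπ : Function.Surjective π :=
    (LinearMap.lTensor_surjective S (LinearMap.range ι).mkQ_surjective).comp eM.surjective
  have hjπ : Function.Exact j π := by
    have h1 : Function.Exact (ι.baseChange S) ((LinearMap.range ι).mkQ.baseChange S) :=
      lTensor_exact S (LinearMap.exact_map_mkQ_range ι) (LinearMap.range ι).mkQ_surjective
    intro x
    rw [LinearMap.comp_apply, LinearEquiv.coe_coe, h1 (eM x)]
    constructor
    · rintro ⟨y, hy⟩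
      exact ⟨y, eM.symm_apply_eq.mpr hy⟩
    · rintro ⟨y, rfl⟩
      exact ⟨y, (eM.apply_symm_apply _).symm⟩
  have h0 : Function.Exact (0 : PUnit →ₗ[S] S ⊗[R] (R ⧸ maximalIdeal R)) j := by
    rw [LinearMap.exact_zero_iff_injective]
    exact hj
  have hinj := map_first_exact_on_four_term_right_exact_of_isSMulRegular_last h0 hjπ hπ hyC
  rw [Submodule.mapQ_zero, LinearMap.exact_zero_iff_injective] at hinj
  have hqM := associatedPrimes.subset_of_injective hinj hq
  have h1 := length_le_ringKrullDim_quotient_of_mem_associatedPrimes hz1'' hz2'' hqM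
  let := Ideal.Quotient.field (maximalIdeal S)
  rw [ringKrullDim_eq_zero_of_field] at h1
  have h1 : zs''.length ≤ 0 := by exact_mod_cast h1
  rw [he]
  exact_mod_cast (by omega : e ≤ ys.length)

end LocalFlat

section Localization

/-- Localizations of Cohen–Macaulay rings at primes are Cohen–Macaulay. -/
theorem IsCohenMacaulayRing.localization {R : Type*} [CommRing R] [IsNoetherianRing R]
    (h : IsCohenMacaulayRing R) (p : Ideal R) [hp : p.IsPrime] :
    IsCohenMacaulayLocalRing (Localization.AtPrime p) := by
  obtain ⟨M, hM, hpM⟩ := p.exists_le_maximal hp.ne_top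
  have := hM.isPrime
  have hdisj : Disjoint (M.primeCompl : Set R) p :=
    Set.disjoint_left.mpr fun x hx hxp ↦ hx (hpM hxp)
  let P : Ideal (Localization.AtPrime M) := p.map (algebraMap R _)
  have hP : P.IsPrime := IsLocalization.isPrime_of_isPrime_disjoint M.primeCompl _ p hp hdisj
  have hcomap : P.comap (algebraMap R (Localization.AtPrime M)) = p :=
    IsLocalization.under_map_of_isPrime_disjoint M.primeCompl _ hp hdisj
  have := IsLocalization.isLocalization_isLocalization_atPrime_isLocalization M.primeCompl
    (Localization.AtPrime P) P
  have h1 := (h M hM).localization P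
  have : IsLocalization.AtPrime (Localization.AtPrime P) p := by
    convert this
    exact hcomap.symm
  exact h1.of_ringEquiv (IsLocalization.algEquiv p.primeCompl (Localization.AtPrime P)
    (Localization.AtPrime p)).toRingEquiv

lemma isCohenMacaulayLocalRing_localization_comap_iff {R S : Type*} [CommRing R] [CommRing S]
    [IsNoetherianRing R] (e : R ≃+* S) (p : Ideal R) [p.IsPrime] (q : Ideal S) [q.IsPrime]
    (h : p = q.comap e) :
    IsCohenMacaulayLocalRing (Localization.AtPrime p) ↔
      IsCohenMacaulayLocalRing (Localization.AtPrime q) := by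
  have : IsNoetherianRing S := isNoetherianRing_of_ringEquiv R e
  let e' := Localization.localRingEquiv p q e h
  exact ⟨fun h ↦ h.of_ringEquiv e', fun h ↦ h.of_ringEquiv e'.symm⟩

/-- Along a flat ring map, a localization at a prime is Cohen–Macaulay if and only if so are the
localization of the base and that of the fibre. -/
theorem isCohenMacaulayLocalRing_localization_iff_of_flat {R S : Type*} [CommRing R] [CommRing S]
    [Algebra R S] [IsNoetherianRing R] [IsNoetherianRing S] [Module.Flat R S] (p : Ideal R)
    [p.IsPrime] (Q : Ideal (p.Fiber S)) [Q.IsPrime] (P : Ideal S) [P.IsPrime]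
    (hP : P = Q.comap (Algebra.TensorProduct.includeRight : S →ₐ[R] p.Fiber S)) :
    IsCohenMacaulayLocalRing (Localization.AtPrime P) ↔
      IsCohenMacaulayLocalRing (Localization.AtPrime p) ∧
        IsCohenMacaulayLocalRing (Localization.AtPrime Q) := by
  subst hP
  let P : Ideal S := Q.comap (Algebra.TensorProduct.includeRight : S →ₐ[R] p.Fiber S)
  have : P.LiesOver p := inferInstance
  let := Localization.AtPrime.algebraOfLiesOver p P
  have e := (Ideal.Fiber.localizationAlgEquivQuotient p Q).toRingEquiv
  have hmap : (maximalIdeal (Localization.AtPrime p)).map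
      (algebraMap (Localization.AtPrime p) (Localization.AtPrime P)) =
      p.map (algebraMap R (Localization.AtPrime P)) := by
    rw [← Localization.AtPrime.map_eq_maximalIdeal, Ideal.map_map, ← IsScalarTower.algebraMap_eq]
  let e := (Ideal.quotEquivOfEq hmap).trans e.symm
  have : IsLocalRing (Localization.AtPrime P ⧸ (maximalIdeal (Localization.AtPrime p)).map
      (algebraMap (Localization.AtPrime p) (Localization.AtPrime P))) := e.symm.isLocalRing
  have : IsNoetherianRing (Localization.AtPrime Q) := isNoetherianRing_of_ringEquiv _ e
  constructor
  · intro h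
    obtain ⟨h1, h2⟩ := h.and_of_flat (R := Localization.AtPrime p)
    exact ⟨h1, h2.of_ringEquiv e⟩
  · rintro ⟨h1, h2⟩
    exact .of_flat h1 (h2.of_ringEquiv e.symm)

end Localization

section FieldTensor

lemma IsCohenMacaulayRing.of_ringEquiv {R S : Type*} [CommRing R] [CommRing S]
    [IsNoetherianRing R] (e : R ≃+* S) (h : IsCohenMacaulayRing R) : IsCohenMacaulayRing S := by
  intro q hq
  have := hq.isPrime
  have hp : (q.comap e).IsPrime := q.comap_isPrime e
  exact (isCohenMacaulayLocalRing_localization_comap_iff e (q.comap e) q rfl).mp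
    (h.localization _)

/-- A Noetherian local ring whose maximal ideal is principal is Cohen–Macaulay. -/
theorem IsCohenMacaulayLocalRing.of_isPrincipal {R : Type*} [CommRing R] [IsLocalRing R]
    [IsNoetherianRing R] (h : (maximalIdeal R).IsPrincipal) : IsCohenMacaulayLocalRing R := by
  obtain ⟨t, ht⟩ := h.principal
  have htm : t ∈ maximalIdeal R := ht ▸ Submodule.mem_span_singleton_self t
  rw [isCohenMacaulayLocalRing_iff]
  by_cases hreg : IsSMulRegular R t
  · refine ⟨[t], .cons hreg (.nil R _), by simpa using htm, ?_⟩
    have := Ideal.height_le_one_of_isPrincipal_of_mem_minimalPrimes (maximalIdeal R)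
      (maximalIdeal R) (by simp [Ideal.minimalPrimes_eq_subsingleton_self])
    rw [← maximalIdeal_height_eq_ringKrullDim]
    exact_mod_cast this
  · refine ⟨[], .nil R R, by simp, ?_⟩
    have hnil : IsNilpotent t := by
      obtain ⟨x, hx, hx0⟩ : ∃ x, t * x = 0 ∧ x ≠ 0 := by
        simpa [isSMulRegular_iff_right_eq_zero_of_smul] using hreg
      obtain ⟨n, hn⟩ : ∃ n, x ∉ maximalIdeal R ^ n := by
        by_contra! H
        have : x ∈ (⨅ i, maximalIdeal R ^ i : Ideal R) := by simpa using H
        rw [Ideal.iInf_pow_eq_bot_of_isLocalRing _ Ideal.IsPrime.ne_top'] at this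
        exact hx0 this
      have key : ∀ m, (∃ y, x = t ^ m * y) ∨ IsNilpotent t := by
        intro m
        induction m with
        | zero => exact .inl ⟨x, by simp⟩
        | succ m ih =>
          refine ih.elim (fun ⟨y, hy⟩ ↦ ?_) .inr
          by_cases hym : y ∈ maximalIdeal R
          · rw [ht, Ideal.submodule_span_eq, Ideal.mem_span_singleton] at hym
            obtain ⟨z, rfl⟩ := hym
            exact .inl ⟨z, by rw [hy]; ring⟩
          · refine .inr ⟨m + 1, ?_⟩
            have hu : IsUnit y := by simpa using hym
            rw [← hu.mul_left_eq_zero, pow_succ', mul_assoc, ← hy, hx]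
      refine (key n).elim (fun ⟨y, hy⟩ ↦ (hn ?_).elim) id
      exact hy ▸ Ideal.mul_mem_right _ _ (Ideal.pow_mem_pow htm n)
    have : Ring.KrullDimLE 0 R := by
      rw [Ring.krullDimLE_zero_iff]
      intro p hp
      convert maximalIdeal.isMaximal R
      refine le_antisymm (le_maximalIdeal hp.ne_top) ?_
      rw [ht, Submodule.span_singleton_le_iff_mem]
      exact hp.mem_of_pow_mem _ (by rw [hnil.choose_spec]; exact p.zero_mem)
    simpa using Ring.krullDimLE_iff.mp this

lemma IsCohenMacaulayRing.of_isPrincipalIdealRing (R : Type*) [CommRing R]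
    [IsPrincipalIdealRing R] : IsCohenMacaulayRing R := by
  intro p hp
  have := hp.isPrime
  refine .of_isPrincipal ?_
  obtain ⟨t, ht⟩ := (IsPrincipalIdealRing.principal p).principal
  have hmap : p.map (algebraMap R (Localization.AtPrime p)) = Ideal.span {algebraMap R _ t} := by
    rw [← Set.image_singleton, ← Ideal.map_span]
    exact congrArg _ ht
  rw [← Localization.AtPrime.map_eq_maximalIdeal, hmap]
  exact ⟨⟨_, rfl⟩⟩

/-- The tensor product of a simple field extension with a field is a principal ideal ring. -/
theorem IsPrincipalIdealRing.tensorProduct_of_adjoin_eq_top {k κ K : Type*} [Field k] [Field κ]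
    [Field K] [Algebra k κ] [Algebra k K] (x : K) (hx : IntermediateField.adjoin k {x} = ⊤) :
    IsPrincipalIdealRing (κ ⊗[k] K) := by
  let φ : Polynomial κ →+* κ ⊗[k] K :=
    (Polynomial.aeval (R := κ) ((1 : κ) ⊗ₜ[k] x)).toRingHom
  have hφ (p : Polynomial k) : (1 : κ) ⊗ₜ[k] Polynomial.aeval x p ∈ φ.range := by
    refine ⟨p.map (algebraMap k κ), ?_⟩
    have := Polynomial.aeval_algHom_apply
      (Algebra.TensorProduct.includeRight : K →ₐ[k] κ ⊗[k] K) x p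
    simpa [φ] using this
  have hfrac (z : κ ⊗[k] K) : ∃ d : K, d ≠ 0 ∧ (1 : κ) ⊗ₜ[k] d ∈ φ.range ∧
      (1 : κ) ⊗ₜ[k] d * z ∈ φ.range := by
    induction z with
    | zero => exact ⟨1, one_ne_zero, one_mem _, by simp⟩
    | add y z hy hz =>
      obtain ⟨d, hd, h1, h2⟩ := hy
      obtain ⟨e, he, h3, h4⟩ := hz
      have : (1 : κ) ⊗ₜ[k] (d * e) = (1 ⊗ₜ d) * (1 ⊗ₜ e) := by simp
      refine ⟨d * e, mul_ne_zero hd he, this ▸ mul_mem h1 h3, ?_⟩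
      rw [this, show ((1 : κ) ⊗ₜ[k] d) * (1 ⊗ₜ e) * (y + z) = (1 ⊗ₜ e) * ((1 ⊗ₜ d) * y)
        + (1 ⊗ₜ d) * ((1 ⊗ₜ e) * z) by ring]
      exact add_mem (mul_mem h3 h2) (mul_mem h1 h4)
    | tmul a b =>
      have hb : b ∈ IntermediateField.adjoin k {x} := hx ▸ IntermediateField.mem_top
      obtain ⟨r, s, rfl⟩ := (IntermediateField.mem_adjoin_simple_iff k b).mp hb
      by_cases hs : Polynomial.aeval x s = 0
      · exact ⟨1, one_ne_zero, one_mem _, by simp [hs]⟩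
      · refine ⟨Polynomial.aeval x s, hs, hφ s, ?_⟩
        rw [Algebra.TensorProduct.tmul_mul_tmul, one_mul, mul_div_cancel₀ _ hs,
          ← mul_one a, ← one_mul (Polynomial.aeval x r), ← Algebra.TensorProduct.tmul_mul_tmul]
        refine mul_mem ⟨Polynomial.C a, ?_⟩ (hφ r)
        simp [φ, Algebra.TensorProduct.algebraMap_apply]
  refine ⟨fun I ↦ ⟨?_⟩⟩
  obtain ⟨f, hf⟩ := (IsPrincipalIdealRing.principal (I.comap φ)).principal
  have hfI : φ f ∈ I := by
    rw [← Ideal.mem_comap, hf]; exact Submodule.mem_span_singleton_self f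
  refine ⟨φ f, le_antisymm (fun z hz ↦ ?_) ?_⟩
  · obtain ⟨d, hd, -, g, hg⟩ := hfrac z
    have hgI : g ∈ I.comap φ := by rw [Ideal.mem_comap, hg]; exact I.mul_mem_left _ hz
    rw [hf, Ideal.submodule_span_eq, Ideal.mem_span_singleton] at hgI
    obtain ⟨c, rfl⟩ := hgI
    rw [Ideal.submodule_span_eq, Ideal.mem_span_singleton]
    refine ⟨1 ⊗ₜ d⁻¹ * φ c, ?_⟩
    rw [mul_left_comm, ← map_mul, hg, ← mul_assoc, Algebra.TensorProduct.tmul_mul_tmul,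
      inv_mul_cancel₀ hd, one_mul, ← Algebra.TensorProduct.one_def, one_mul]
  · rw [Submodule.span_singleton_le_iff_mem]
    exact hfI

/-- Every prime of the target of a ring map is the contraction of a prime of the fibre. -/
lemma exists_isPrime_fiber_comap_eq {R S : Type*} [CommRing R] [CommRing S] [Algebra R S]
    (p : Ideal R) [p.IsPrime] (P : Ideal S) [P.IsPrime] (h : P.comap (algebraMap R S) = p) :
    ∃ Q : Ideal (p.Fiber S), Q.IsPrime ∧
      P = Q.comap (Algebra.TensorProduct.includeRight : S →ₐ[R] p.Fiber S) := by
  have : P.LiesOver p := ⟨h.symm⟩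
  let Q := PrimeSpectrum.primesOverOrderIsoFiber R S p ⟨P, ‹_›, ‹_›⟩
  refine ⟨Q.asIdeal, Q.isPrime, ?_⟩
  have := PrimeSpectrum.coe_primesOverOrderIsoFiber_symm_apply (p := p) (S := S) Q
  simpa [Q] using this

instance {R S : Type*} [CommRing R] [CommRing S] [Algebra R S] [IsNoetherianRing S]
    (p : Ideal R) [p.IsPrime] : IsNoetherianRing (p.Fiber S) :=
  have : IsNoetherianRing (S ⊗[R] p.ResidueField) := Algebra.EssFiniteType.isNoetherianRing S _
  isNoetherianRing_of_ringEquiv _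
    (Algebra.TensorProduct.comm R S p.ResidueField).toRingEquiv

/-- Along a flat map of Noetherian rings with Cohen–Macaulay fibres, being Cohen–Macaulay
ascends. -/
theorem IsCohenMacaulayRing.of_flat {R S : Type*} [CommRing R] [CommRing S] [Algebra R S]
    [IsNoetherianRing R] [IsNoetherianRing S] [Module.Flat R S] (hR : IsCohenMacaulayRing R)
    (h : ∀ (p : Ideal R) [p.IsPrime], IsCohenMacaulayRing (p.Fiber S)) :
    IsCohenMacaulayRing S := by
  intro P hP
  have := hP.isPrime
  have hp : (P.comap (algebraMap R S)).IsPrime := P.comap_isPrime _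
  obtain ⟨Q, hQ, hPQ⟩ := exists_isPrime_fiber_comap_eq (P.comap (algebraMap R S)) P rfl
  exact (isCohenMacaulayLocalRing_localization_iff_of_flat _ Q P hPQ).mpr
    ⟨hR.localization (P.comap (algebraMap R S)), (h _).localization Q⟩

/-- Base change along a simple field extension preserves Cohen–Macaulay Noetherian algebras. -/
lemma IsCohenMacaulayRing.tensorProduct_of_adjoin_eq_top {k C K : Type*} [Field k] [CommRing C]
    [Field K] [Algebra k C] [Algebra k K] [IsNoetherianRing C] (hC : IsCohenMacaulayRing C)
    (x : K) (hx : IntermediateField.adjoin k {x} = ⊤) :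
    IsNoetherianRing (C ⊗[k] K) ∧ IsCohenMacaulayRing (C ⊗[k] K) := by
  have : Algebra.EssFiniteType k K :=
    IntermediateField.fg_top_iff.mp ⟨{x}, by simpa using hx⟩
  have hN : IsNoetherianRing (C ⊗[k] K) := Algebra.EssFiniteType.isNoetherianRing C _
  refine ⟨hN, hC.of_flat fun p _ ↦ ?_⟩
  have := IsPrincipalIdealRing.tensorProduct_of_adjoin_eq_top (κ := p.ResidueField) x hx
  exact (IsCohenMacaulayRing.of_isPrincipalIdealRing (p.ResidueField ⊗[k] K)).of_ringEquiv
    (Algebra.TensorProduct.cancelBaseChange k C C p.ResidueField K).symm.toRingEquiv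

end FieldTensor

section FieldTensorField

/-- If `P` is extended from its contraction `p` along a flat map, then `S_P` is Cohen–Macaulay
as soon as `R_p` is. -/
lemma IsCohenMacaulayLocalRing.localization_of_flat_of_eq_map {R S : Type*} [CommRing R]
    [CommRing S] [Algebra R S] [IsNoetherianRing R] [IsNoetherianRing S] [Module.Flat R S]
    (p : Ideal R) [p.IsPrime] (P : Ideal S) [P.IsPrime] [P.LiesOver p]
    (h : P = p.map (algebraMap R S)) (hp : IsCohenMacaulayLocalRing (Localization.AtPrime p)) :
    IsCohenMacaulayLocalRing (Localization.AtPrime P) := by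
  let := Localization.AtPrime.algebraOfLiesOver p P
  have hmap : (maximalIdeal (Localization.AtPrime p)).map
      (algebraMap (Localization.AtPrime p) (Localization.AtPrime P)) =
      maximalIdeal (Localization.AtPrime P) := by
    rw [← Localization.AtPrime.map_eq_maximalIdeal, Ideal.map_map, ← IsScalarTower.algebraMap_eq,
      IsScalarTower.algebraMap_eq R S (Localization.AtPrime P), ← Ideal.map_map, ← h,
      Localization.AtPrime.map_eq_maximalIdeal]
  let e : _ ≃+* ResidueField (Localization.AtPrime P) := Ideal.quotEquivOfEq hmap
  have : IsLocalRing (Localization.AtPrime P ⧸ (maximalIdeal (Localization.AtPrime p)).map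
      (algebraMap (Localization.AtPrime p) (Localization.AtPrime P))) :=
    e.symm.isLocalRing
  refine .of_flat hp (IsCohenMacaulayLocalRing.of_ringEquiv e.symm (.of_isPrincipal ?_))
  exact IsPrincipalIdealRing.principal _

section Tower

variable (k E K L : Type*) [Field k] [Field E] [Field K] [Field L] [Algebra k E] [Algebra k K]
  [Algebra k L] [Algebra E K] [IsScalarTower k E K]

/-- Base change in stages: `(E ⊗[k] L) ⊗[E] K ≃ K ⊗[k] L`. -/
noncomputable def tensorTensorFieldEquiv : (E ⊗[k] L) ⊗[E] K ≃+* K ⊗[k] L :=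
  (Algebra.TensorProduct.comm E (E ⊗[k] L) K).toRingEquiv.trans
    (Algebra.TensorProduct.cancelBaseChange k E E K L).toRingEquiv

lemma tensorTensorFieldEquiv_algebraMap (c : E ⊗[k] L) :
    tensorTensorFieldEquiv k E K L (algebraMap _ ((E ⊗[k] L) ⊗[E] K) c) =
      Algebra.TensorProduct.map (IsScalarTower.toAlgHom k E K) (AlgHom.id k L) c := by
  induction c with
  | zero => simp
  | add x y hx hy => simp only [map_add, hx, hy]
  | tmul x y =>
    simp [tensorTensorFieldEquiv, Algebra.TensorProduct.algebraMap_apply, Algebra.smul_def]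

variable {k E K L}

lemma isNoetherianRing_and_isCohenMacaulayRing_tensorProduct_of_adjoin_eq_top
    (h : IsNoetherianRing (E ⊗[k] L) ∧ IsCohenMacaulayRing (E ⊗[k] L)) (x : K)
    (hx : IntermediateField.adjoin E {x} = ⊤) :
    IsNoetherianRing (K ⊗[k] L) ∧ IsCohenMacaulayRing (K ⊗[k] L) := by
  obtain ⟨hN, hCM⟩ := h
  obtain ⟨hN', hCM'⟩ := hCM.tensorProduct_of_adjoin_eq_top x hx
  let e := tensorTensorFieldEquiv k E K L
  exact ⟨isNoetherianRing_of_ringEquiv _ e, hCM'.of_ringEquiv e⟩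

lemma isCohenMacaulayLocalRing_localization_tensorProduct_of_subset_range
    [IsNoetherianRing (E ⊗[k] L)] [IsNoetherianRing (K ⊗[k] L)]
    (h : IsCohenMacaulayRing (E ⊗[k] L)) (s : Set (K ⊗[k] L))
    (hs : s ⊆ (Algebra.TensorProduct.map (IsScalarTower.toAlgHom k E K) (AlgHom.id k L)).range)
    (P : Ideal (K ⊗[k] L)) [P.IsPrime] (hP : Ideal.span s = P) :
    IsCohenMacaulayLocalRing (Localization.AtPrime P) := by
  let e := tensorTensorFieldEquiv k E K L
  have : IsNoetherianRing ((E ⊗[k] L) ⊗[E] K) := isNoetherianRing_of_ringEquiv _ e.symm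
  let P' := P.comap e
  have hP' : P'.IsPrime := P.comap_isPrime e
  let p := P'.comap (algebraMap (E ⊗[k] L) _)
  have hp : p.IsPrime := P'.comap_isPrime _
  have : P'.LiesOver p := ⟨rfl⟩
  refine (isCohenMacaulayLocalRing_localization_comap_iff e P' P rfl).mp
    (.localization_of_flat_of_eq_map p P' (le_antisymm ?_ Ideal.map_comap_le) (h.localization p))
  suffices P ≤ (p.map (algebraMap (E ⊗[k] L) _)).comap e.symm by
    intro z hz
    simpa using this hz
  rw [← hP, Ideal.span_le]
  intro z hz
  obtain ⟨c, hc⟩ := hs hz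
  replace hc : e (algebraMap _ _ c) = z := by rw [← hc]; exact tensorTensorFieldEquiv_algebraMap ..
  have hzP : z ∈ P := hP ▸ Ideal.subset_span hz
  rw [SetLike.mem_coe, Ideal.mem_comap, ← hc, RingEquiv.symm_apply_apply]
  refine Ideal.mem_map_of_mem _ ?_
  rwa [← hc] at hzP

end Tower

lemma isNoetherianRing_and_isCohenMacaulayRing_tensorProduct_of_fg {k K : Type*} (L : Type*)
    [Field k] [Field K] [Field L] [Algebra k K] [Algebra k L] (E : IntermediateField k K)
    (hE : E.FG) : IsNoetherianRing (E ⊗[k] L) ∧ IsCohenMacaulayRing (E ⊗[k] L) := by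
  refine IntermediateField.induction_on_adjoin_fg
    (fun E ↦ IsNoetherianRing (E ⊗[k] L) ∧ IsCohenMacaulayRing (E ⊗[k] L)) ?_ ?_ E hE
  · let e : L ≃+* (⊥ : IntermediateField k K) ⊗[k] L :=
      ((Algebra.TensorProduct.congr (IntermediateField.botEquiv k K) .refl).trans
        (Algebra.TensorProduct.lid k L)).symm.toRingEquiv
    exact ⟨isNoetherianRing_of_ringEquiv L e,
      (IsCohenMacaulayRing.of_isPrincipalIdealRing L).of_ringEquiv e⟩
  · intro E x h
    have hx : IntermediateField.adjoin E {IntermediateField.AdjoinSimple.gen E x} = ⊤ := by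
      apply IntermediateField.lift_injective
      simp
    exact (isNoetherianRing_and_isCohenMacaulayRing_tensorProduct_of_adjoin_eq_top
      (K := IntermediateField.adjoin E {x}) h _ hx :)

/-- A Noetherian tensor product of two fields is Cohen–Macaulay. -/
theorem isCohenMacaulayRing_tensorProduct_field (k K L : Type*)
    [Field k] [Field K] [Field L] [Algebra k K] [Algebra k L] [IsNoetherianRing (K ⊗[k] L)] :
    IsCohenMacaulayRing (K ⊗[k] L) := by
  intro P hP
  have := hP.isPrime
  obtain ⟨s, hs⟩ := IsNoetherian.noetherian P
  obtain ⟨M, hM, hsM⟩ :=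
    TensorProduct.exists_finite_submodule_left_of_setFinite (s : Set (K ⊗[k] L)) s.finite_toSet
  obtain ⟨t, ht⟩ := Module.Finite.iff_fg.mp hM
  let E := IntermediateField.adjoin k (t : Set K)
  obtain ⟨hN, hCM⟩ := isNoetherianRing_and_isCohenMacaulayRing_tensorProduct_of_fg L E ⟨t, rfl⟩
  have hME : M ≤ Subalgebra.toSubmodule E.toSubalgebra := by
    rw [← ht, Submodule.span_le]
    exact IntermediateField.subset_adjoin k _
  refine isCohenMacaulayLocalRing_localization_tensorProduct_of_subset_range hCM s ?_ P hs
  intro z hz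
  obtain ⟨c, rfl⟩ := hsM hz
  refine ⟨(Submodule.inclusion hME).rTensor L c, ?_⟩
  change ((IsScalarTower.toAlgHom k E K).toLinearMap.rTensor L) _ = _
  rw [← LinearMap.comp_apply, ← LinearMap.rTensor_comp]
  rfl

end FieldTensorField

section TensorProduct

/-- For a field extension `K / k`, a prime of `D ⊗[k] K` is a Cohen–Macaulay point if and only if
its contraction to `D` is. -/
lemma isCohenMacaulayLocalRing_localization_tensorProduct_field_iff {k D K : Type*} [Field k]
    [CommRing D] [Field K] [Algebra k D] [Algebra k K] [IsNoetherianRing D]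
    [IsNoetherianRing (D ⊗[k] K)] (Q : Ideal (D ⊗[k] K)) [Q.IsPrime] (q : Ideal D) [q.IsPrime]
    (hq : Q.comap (algebraMap D (D ⊗[k] K)) = q) :
    IsCohenMacaulayLocalRing (Localization.AtPrime Q) ↔
      IsCohenMacaulayLocalRing (Localization.AtPrime q) := by
  obtain ⟨Q', hQ', hQQ'⟩ := exists_isPrime_fiber_comap_eq q Q hq
  rw [isCohenMacaulayLocalRing_localization_iff_of_flat q Q' Q hQQ', and_iff_left]
  let e : q.Fiber (D ⊗[k] K) ≃+* q.ResidueField ⊗[k] K :=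
    (Algebra.TensorProduct.cancelBaseChange k D D q.ResidueField K).toRingEquiv
  have : IsNoetherianRing (q.ResidueField ⊗[k] K) := isNoetherianRing_of_ringEquiv _ e
  exact ((isCohenMacaulayRing_tensorProduct_field k q.ResidueField K).of_ringEquiv
    e.symm).localization Q'

/-- Base change in stages: `K ⊗[A] (A ⊗[R] B) ≃ (k ⊗[R] B) ⊗[k] K`. -/
noncomputable def tensorTensorEquivTensorTensor (R A B k K : Type*) [CommRing R] [CommRing A]
    [CommRing B] [CommRing k] [CommRing K] [Algebra R A] [Algebra R B] [Algebra R k] [Algebra R K]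
    [Algebra A K] [Algebra k K] [IsScalarTower R A K] [IsScalarTower R k K] :
    K ⊗[A] (A ⊗[R] B) ≃+* (k ⊗[R] B) ⊗[k] K :=
  (Algebra.TensorProduct.cancelBaseChange R A A K B).toRingEquiv.trans
    ((Algebra.TensorProduct.comm k (k ⊗[R] B) K).toRingEquiv.trans
      (Algebra.TensorProduct.cancelBaseChange R k k K B).toRingEquiv).symm

lemma tensorTensorEquivTensorTensor_one_tmul {R A B k K : Type*} [CommRing R] [CommRing A]
    [CommRing B] [CommRing k] [CommRing K] [Algebra R A] [Algebra R B] [Algebra R k] [Algebra R K]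
    [Algebra A K] [Algebra k K] [IsScalarTower R A K] [IsScalarTower R k K] (b : B) :
    tensorTensorEquivTensorTensor R A B k K (1 ⊗ₜ (1 ⊗ₜ b)) = (1 ⊗ₜ b) ⊗ₜ 1 := by
  simp [tensorTensorEquivTensorTensor]

lemma isCohenMacaulayLocalRing_localization_iff_of_equiv_tensorProduct_field {k D K W : Type*}
    [Field k] [CommRing D] [Field K] [CommRing W] [Algebra k D] [Algebra k K] [IsNoetherianRing D]
    [IsNoetherianRing W] (e : W ≃+* D ⊗[k] K) (Q : Ideal W) [Q.IsPrime] (q : Ideal D) [q.IsPrime]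
    (hq : ∀ d : D, d ∈ q ↔ e.symm (d ⊗ₜ 1) ∈ Q) :
    IsCohenMacaulayLocalRing (Localization.AtPrime Q) ↔
      IsCohenMacaulayLocalRing (Localization.AtPrime q) := by
  have : IsNoetherianRing (D ⊗[k] K) := isNoetherianRing_of_ringEquiv _ e
  let Q' := Q.comap e.symm
  have hQ' : Q'.IsPrime := Q.comap_isPrime e.symm
  have hQQ' : Q = Q'.comap e := by
    ext x
    change _ ↔ e.symm (e x) ∈ Q
    rw [RingEquiv.symm_apply_apply]
  rw [isCohenMacaulayLocalRing_localization_comap_iff e Q Q' hQQ']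
  exact isCohenMacaulayLocalRing_localization_tensorProduct_field_iff Q' q
    (Ideal.ext fun d ↦ (hq d).symm)

/-- A prime of `A ⊗[R] B` is a Cohen–Macaulay point if and only if both of its contractions
are. -/
theorem isCohenMacaulayLocalRing_localization_tensorProduct_iff {R A B : Type*} [CommRing R]
    [CommRing A] [CommRing B] [Algebra R A] [Algebra R B] [Module.Flat R B] [IsNoetherianRing R]
    [IsNoetherianRing A] [IsNoetherianRing B] [IsNoetherianRing (A ⊗[R] B)]
    (hR : IsCohenMacaulayRing R) (P : Ideal (A ⊗[R] B)) [P.IsPrime] (p : Ideal A) [p.IsPrime]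
    (q : Ideal B) [q.IsPrime] (hp : P.comap (algebraMap A (A ⊗[R] B)) = p)
    (hq : P.comap (Algebra.TensorProduct.includeRight : B →ₐ[R] A ⊗[R] B) = q) :
    IsCohenMacaulayLocalRing (Localization.AtPrime P) ↔
      IsCohenMacaulayLocalRing (Localization.AtPrime p) ∧
        IsCohenMacaulayLocalRing (Localization.AtPrime q) := by
  obtain ⟨P', hP', hPP'⟩ := exists_isPrime_fiber_comap_eq p P hp
  let r := p.comap (algebraMap R A)
  have hr : r.IsPrime := p.comap_isPrime _
  let : Algebra r.ResidueField p.ResidueField :=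
    (Ideal.ResidueField.map r p (algebraMap R A) rfl).toAlgebra
  have : IsScalarTower R r.ResidueField p.ResidueField := .of_algebraMap_eq fun x ↦ by
    rw [RingHom.algebraMap_toAlgebra, Ideal.ResidueField.map_algebraMap,
      ← IsScalarTower.algebraMap_apply]
  let e : p.Fiber (A ⊗[R] B) ≃+* r.Fiber B ⊗[r.ResidueField] p.ResidueField :=
    tensorTensorEquivTensorTensor R A B r.ResidueField p.ResidueField
  let ι : r.Fiber B →+* p.Fiber (A ⊗[R] B) :=
    (e.symm : _ →+* _).comp (algebraMap (r.Fiber B) (r.Fiber B ⊗[r.ResidueField] p.ResidueField))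
  let Q := P'.comap ι
  have hQ : Q.IsPrime := P'.comap_isPrime ι
  have hqQ : q = Q.comap (Algebra.TensorProduct.includeRight : B →ₐ[R] r.Fiber B) := by
    ext b
    have h : e.symm ((1 ⊗ₜ b) ⊗ₜ 1) = 1 ⊗ₜ (1 ⊗ₜ b) := by
      rw [RingEquiv.symm_apply_eq]
      exact (tensorTensorEquivTensorTensor_one_tmul b).symm
    rw [← hq, hPP']
    change _ ∈ P' ↔ e.symm ((1 ⊗ₜ b) ⊗ₜ 1) ∈ P'
    rw [h]
    rfl
  rw [isCohenMacaulayLocalRing_localization_iff_of_flat p P' P hPP',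
    isCohenMacaulayLocalRing_localization_iff_of_flat r Q q hqQ, and_iff_right (hR.localization r)]
  exact and_congr_right' (isCohenMacaulayLocalRing_localization_iff_of_equiv_tensorProduct_field
    e P' Q fun _ ↦ Iff.rfl)

/-- Two primes with the same contraction are the contractions of a prime of the tensor product. -/
lemma exists_isPrime_tensorProduct_comap_eq {R A B : Type*} [CommRing R] [CommRing A] [CommRing B]
    [Algebra R A] [Algebra R B] (p : Ideal A) [p.IsPrime] (q : Ideal B) [q.IsPrime]
    (h : p.comap (algebraMap R A) = q.comap (algebraMap R B)) :
    ∃ P : Ideal (A ⊗[R] B), P.IsPrime ∧ P.comap (algebraMap A (A ⊗[R] B)) = p ∧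
      P.comap (Algebra.TensorProduct.includeRight : B →ₐ[R] A ⊗[R] B) = q := by
  let r := p.comap (algebraMap R A)
  have hr : r.IsPrime := p.comap_isPrime _
  let f := Ideal.ResidueField.mapₐ r p (Algebra.ofId R A) rfl
  let g := Ideal.ResidueField.mapₐ r q (Algebra.ofId R B) h
  let : Algebra r.ResidueField p.ResidueField := f.toRingHom.toAlgebra
  let : Algebra r.ResidueField q.ResidueField := g.toRingHom.toAlgebra
  have : IsScalarTower R r.ResidueField p.ResidueField := .of_algHom f
  have : IsScalarTower R r.ResidueField q.ResidueField := .of_algHom g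
  let T := p.ResidueField ⊗[r.ResidueField] q.ResidueField
  obtain ⟨m, hm⟩ := Ideal.exists_maximal T
  let F := T ⧸ m
  let : Field F := Ideal.Quotient.field m
  let a : p.ResidueField →ₐ[R] F := ((Ideal.Quotient.mkₐ r.ResidueField m).comp
    Algebra.TensorProduct.includeLeft).restrictScalars R
  let b : q.ResidueField →ₐ[R] F := ((Ideal.Quotient.mkₐ r.ResidueField m).comp
    Algebra.TensorProduct.includeRight).restrictScalars R
  let φ : A ⊗[R] B →ₐ[R] F := Algebra.TensorProduct.productMap
    (a.comp (IsScalarTower.toAlgHom R A p.ResidueField))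
    (b.comp (IsScalarTower.toAlgHom R B q.ResidueField))
  refine ⟨RingHom.ker φ, RingHom.ker_isPrime _, ?_, ?_⟩
  · ext x
    simp [φ, RingHom.mem_ker, Algebra.TensorProduct.algebraMap_apply]
  · ext x
    simp [φ, RingHom.mem_ker]

end TensorProduct

/-- Let `R` be a Cohen–Macaulay commutative (Noetherian) ring, `A`, `B` commutative Noetherian
`R`-algebras with `B` flat over `R`.  Then `A ⊗[R] B` is Cohen–Macaulay if and only if for all
prime ideals `𝔭` of `A` and `𝔮` of `B` with `𝔭 ∩ R = 𝔮 ∩ R`, the localizations `A_𝔭` and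
`B_𝔮` are Cohen–Macaulay. -/
theorem stmt_14 (R A B : Type*) [CommRing R] [CommRing A] [CommRing B]
    [Algebra R A] [Algebra R B] [Module.Flat R B]
    [IsNoetherianRing R] [IsNoetherianRing A] [IsNoetherianRing B]
    [IsNoetherianRing (A ⊗[R] B)]
    (hR : IsCohenMacaulayRing R) :
    IsCohenMacaulayRing (A ⊗[R] B) ↔
      ∀ (𝔭 : Ideal A) (h𝔭 : 𝔭.IsPrime) (𝔮 : Ideal B) (h𝔮 : 𝔮.IsPrime),
        𝔭.comap (algebraMap R A) = 𝔮.comap (algebraMap R B) →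
          (IsCohenMacaulayLocalRing (Localization.AtPrime 𝔭) ∧
            IsCohenMacaulayLocalRing (Localization.AtPrime 𝔮)) := by
  constructor
  · intro h 𝔭 h𝔭 𝔮 h𝔮 h_eq
    obtain ⟨P, hP, hp, hq⟩ := exists_isPrime_tensorProduct_comap_eq 𝔭 𝔮 h_eq
    exact (isCohenMacaulayLocalRing_localization_tensorProduct_iff hR P 𝔭 𝔮 hp hq).mp
      (h.localization P)
  · intro h P hP
    have := hP.isPrime
    have hp : (P.comap (algebraMap A (A ⊗[R] B))).IsPrime := P.comap_isPrime _
    have hq : (P.comap (Algebra.TensorProduct.includeRight : B →ₐ[R] A ⊗[R] B)).IsPrime :=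
      P.comap_isPrime _
    refine (isCohenMacaulayLocalRing_localization_tensorProduct_iff hR P _ _ rfl rfl).mpr
      (h _ hp _ hq ?_)
    ext x
    simp [Algebra.TensorProduct.algebraMap_apply]
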